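/- Let p be a nonconstant polynomial on ℝ^m. Then the limit as a → ∞ of ∫_{[0,1]^m} exp(i·p(a·x)) dx is 0. -/

import Mathlib

open MeasureTheory

lemma ae_eval_ne_zero : ∀ {m : ℕ} (p : MvPolynomial (Fin m) ℝ), p ≠ 0 →
    ∀ᵐ x : Fin m → ℝ, MvPolynomial.eval x p ≠ 0 := by
  intro m
  induction m with
  | zero =>
    intro p hp
    refine Filter.Eventually.of_forall fun x hx => hp ?_
    rw [MvPolynomial.eq_C_of_isEmpty p] at hx ⊢
    simpa using hx
  | succ n ih =>
    intro p hp
    have hq : MvPolynomial.finSuccEquiv ℝ n p ≠ 0 := by simpa using hp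
    have hlc := ih _ (Polynomial.leadingCoeff_ne_zero.mpr hq)
    have key : ∀ᵐ z : (Fin n → ℝ) × ℝ,
        MvPolynomial.eval (Fin.cons z.2 z.1 : Fin (n+1) → ℝ) p ≠ 0 := by
      have hc : Continuous fun z : (Fin n → ℝ) × ℝ =>
          MvPolynomial.eval (Fin.cons z.2 z.1 : Fin (n+1) → ℝ) p := by
        apply (MvPolynomial.continuous_eval p).comp
        fun_prop
      have hm : MeasurableSet {z : (Fin n → ℝ) × ℝ |
          MvPolynomial.eval (Fin.cons z.2 z.1 : Fin (n+1) → ℝ) p = 0} :=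
        (isClosed_eq hc continuous_const).measurableSet
      rw [ae_iff]
      simp only [ne_eq, not_not]
      rw [Measure.volume_eq_prod, Measure.measure_prod_null hm]
      filter_upwards [hlc] with y hy
      have hP : Polynomial.map (MvPolynomial.eval y) (MvPolynomial.finSuccEquiv ℝ n p) ≠ 0 := by
        intro h
        apply hy
        have := congrArg (fun P => Polynomial.coeff P
          (MvPolynomial.finSuccEquiv ℝ n p).natDegree) h
        simpa using this
      apply Set.Finite.measure_zero
      refine (Polynomial.finite_setOfPred_isRoot hP).subset ?_
      intro t ht
      simp only [Set.mem_preimage, Set.mem_ofPred_eq] at ht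
      rw [MvPolynomial.eval_eq_eval_mv_eval'] at ht
      exact ht
    have hpres := volume_preserving_piFinSuccAbove (fun _ : Fin (n+1) => ℝ) 0
    have h2 := hpres.quasiMeasurePreserving.ae
      ((Measure.measurePreserving_swap (μ := (volume : Measure (Fin n → ℝ)))
        (ν := (volume : Measure ℝ))).symm (MeasurableEquiv.prodComm) |>.quasiMeasurePreserving.ae key)
    filter_upwards [h2] with x hx
    convert hx using 3
    simp [MeasurableEquiv.piFinSuccAbove, MeasurableEquiv.prodComm]

lemma key1 (P : Polynomial ℝ) (hP : P.derivative ≠ 0) (ε : ℝ) (hε : 0 < ε) :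
    ∃ T : ℝ, 0 < T ∧ ∀ a b : ℝ, T ≤ a → a ≤ b →
      ‖∫ s in a..b, Complex.exp (Complex.I * (P.eval s : ℝ))‖ ≤ 2 * ε * b := by
  set Q := P.derivative with hQ
  have h1 : Filter.Tendsto (fun x : ℝ => (Q.derivative).eval x / (Q ^ 2).eval x)
      Filter.atTop (nhds 0) := by
    apply Polynomial.div_tendsto_atTop_zero_of_degree_lt
    refine (Polynomial.degree_derivative_lt hP).trans_le ?_
    apply Polynomial.degree_le_of_dvd (Dvd.intro_left _ (by ring : Q * Q = Q^2)) (pow_ne_zero _ hP)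
  have h2 : Filter.Tendsto (fun x : ℝ => (1 : Polynomial ℝ).eval x / (Polynomial.X * Q).eval x)
      Filter.atTop (nhds 0) := by
    apply Polynomial.div_tendsto_atTop_zero_of_degree_lt
    rw [Polynomial.degree_mul, Polynomial.degree_one, Polynomial.degree_X,
      Polynomial.degree_eq_natDegree hP]
    norm_cast
    omega
  have h3 : ∀ᶠ x : ℝ in Filter.atTop, Q.eval x ≠ 0 := by
    have := (Polynomial.finite_setOfPred_isRoot hP)
    filter_upwards [Filter.atTop_le_cofinite this.compl_mem_cofinite] with x hx using hx
  have h1' := (Metric.tendsto_nhds.mp h1) ε hε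
  have h2' := (Metric.tendsto_nhds.mp h2) ε hε
  obtain ⟨T, hT⟩ := Filter.eventually_atTop.mp (h1'.and (h2'.and (h3.and (Filter.eventually_gt_atTop 0))))
  refine ⟨T, (hT T le_rfl).2.2.2, fun a b ha hab => ?_⟩
  have hT0 := (hT T le_rfl).2.2.2
  let f : ℝ → ℂ := fun s => Complex.exp (Complex.I * (P.eval s : ℝ)) / (Complex.I * (Q.eval s : ℝ))
  let g : ℝ → ℂ := fun s => Complex.exp (Complex.I * (P.eval s : ℝ)) *
     ((Q.derivative.eval s / (Q^2).eval s : ℝ) / Complex.I)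
  have hexp : ∀ s, ‖Complex.exp (Complex.I * (P.eval s : ℝ))‖ = 1 := by
    intro s; rw [mul_comm]; exact Complex.norm_exp_ofReal_mul_I _
  have hf : ∀ s, T ≤ s → HasDerivAt f (Complex.exp (Complex.I * (P.eval s : ℝ)) - g s) s := by
    intro s hs
    have hq := (hT s hs).2.2.1
    have hqc : ((Q.eval s : ℝ) : ℂ) ≠ 0 := by exact_mod_cast hq
    have e1 : HasDerivAt (fun s : ℝ => Complex.exp (Complex.I * (P.eval s : ℝ)))
      (Complex.exp (Complex.I * (P.eval s : ℝ)) * (Complex.I * (Q.eval s : ℝ))) s :=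
      (((P.hasDerivAt s).ofReal_comp).const_mul Complex.I).cexp
    have e2 : HasDerivAt (fun s : ℝ => Complex.I * ((Q.eval s : ℝ) : ℂ))
      (Complex.I * (Q.derivative.eval s : ℝ)) s :=
      (((Q.hasDerivAt s).ofReal_comp).const_mul Complex.I)
    have e3 : HasDerivAt f _ s := e1.div e2 (mul_ne_zero Complex.I_ne_zero hqc)
    refine e3.congr_deriv ?_
    simp only [g]
    push_cast
    rw [Polynomial.eval_pow]
    push_cast
    field_simp
  have hfb : ∀ s, T ≤ s → ‖f s‖ ≤ ε * s := by
    intro s hs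
    have hs0 : 0 < s := hT0.trans_le hs
    have := (hT s hs).2.1
    have hq := (hT s hs).2.2.1
    simp only [f, norm_div, hexp, norm_mul, Complex.norm_I, one_mul, Complex.norm_real]
    simp only [Polynomial.eval_one, Polynomial.eval_mul, Polynomial.eval_X, dist_zero_right,
      norm_div, norm_one, norm_mul, Real.norm_of_nonneg hs0.le] at this
    have hq' : 0 < ‖Q.eval s‖ := norm_pos_iff.mpr hq
    rw [div_lt_iff₀ (by positivity)] at this
    rw [div_le_iff₀ hq']
    nlinarith
  have hgb : ∀ s, T ≤ s → ‖g s‖ ≤ ε := by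
    intro s hs
    have := (hT s hs).1
    simp only [g, norm_mul, hexp, norm_div, Complex.norm_I, Complex.norm_real, one_mul, div_one]
    simp only [dist_zero_right, norm_div] at this
    exact this.le
  have hec : Continuous fun s : ℝ => Complex.exp (Complex.I * (P.eval s : ℝ)) := by fun_prop
  have hgc : ContinuousOn g (Set.uIcc a b) := by
    rw [Set.uIcc_of_le hab]
    apply hec.continuousOn.mul
    apply ContinuousOn.div_const
    apply Complex.continuous_ofReal.comp_continuousOn
    apply Q.derivative.continuous.continuousOn.div (Q^2).continuous.continuousOn
    intro s hs
    simpa using (hT s (ha.trans hs.1)).2.2.1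
  have hgi := hgc.intervalIntegrable (μ := volume)
  have hei := hec.intervalIntegrable (μ := volume) a b
  have hftc := intervalIntegral.integral_eq_sub_of_hasDerivAt (a := a) (b := b) (f := f)
    (fun s hs => hf s (by rw [Set.uIcc_of_le hab] at hs; exact ha.trans hs.1)) (hei.sub hgi)
  rw [intervalIntegral.integral_sub hei hgi, sub_eq_iff_eq_add] at hftc
  rw [hftc]
  have hg : ‖∫ s in a..b, g s‖ ≤ ε * |b - a| := by
    apply intervalIntegral.norm_integral_le_of_norm_le_const
    intro s hs
    rw [Set.uIoc_of_le hab] at hs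
    exact hgb s (ha.trans hs.1.le)
  rw [abs_of_nonneg (by linarith)] at hg
  have i1 := norm_add_le (f b - f a) (∫ s in a..b, g s)
  have i2 := norm_sub_le (f b) (f a)
  have i3 := hfb a ha
  have i4 := hfb b (ha.trans hab)
  linarith

lemma key2 (P : Polynomial ℝ) (hP : P.derivative ≠ 0) (b : ℝ) (hb : 1 ≤ b) :
    Filter.Tendsto (fun a : ℝ => ∫ s in (1:ℝ)..b, Complex.exp (Complex.I * (P.eval (a * s) : ℝ)))
      Filter.atTop (nhds 0) := by
  rw [Metric.tendsto_nhds]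
  intro ε hε
  obtain ⟨T, hT0, hT⟩ := key1 P hP (ε / (4 * b)) (by positivity)
  filter_upwards [Filter.eventually_ge_atTop T] with a ha
  have ha0 : 0 < a := hT0.trans_le ha
  rw [intervalIntegral.integral_comp_mul_left
    (fun s => Complex.exp (Complex.I * (P.eval s : ℝ))) ha0.ne', dist_zero_right, norm_smul,
    norm_inv, Real.norm_of_nonneg ha0.le, mul_one]
  have := hT a (a * b) ha (by nlinarith)
  rw [inv_mul_lt_iff₀ ha0]
  refine this.trans_lt ?_
  have : 2 * (ε / (4 * b)) * (a * b) = ε * a / 2 := by field_simp; ring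
  rw [this]
  nlinarith [mul_pos hε ha0]

open scoped Pointwise in
lemma scale_bound {m : ℕ} (G : (Fin m → ℝ) → ℂ) (hG : Continuous G) (hn : ∀ x, ‖G x‖ ≤ 1)
    (s : ℝ) (hs : 1 ≤ s) :
    ‖(∫ x in Set.Icc (0 : Fin m → ℝ) 1, G (s • x)) - ∫ x in Set.Icc (0 : Fin m → ℝ) 1, G x‖
      ≤ 2 * (s ^ m - 1) := by
  have hs0 : 0 < s := by linarith
  have hvol : ∀ t : ℝ, 0 ≤ t → volume.real (Set.Icc (0 : Fin m → ℝ) (fun _ => t)) = t ^ m := by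
    intro t ht
    have := Real.volume_Icc_pi_toReal (a := (0 : Fin m → ℝ)) (b := fun _ => t) (fun i => ht)
    rw [measureReal_def, this]
    simp
  have hset : s • Set.Icc (0 : Fin m → ℝ) 1 = Set.Icc (0 : Fin m → ℝ) (fun _ => s) := by
    ext x
    rw [Set.mem_smul_set_iff_inv_smul_mem₀ hs0.ne']
    simp only [Set.mem_Icc, Pi.le_def, Pi.smul_apply, smul_eq_mul, Pi.zero_apply, Pi.one_apply]
    refine and_congr (forall_congr' fun i => ?_) (forall_congr' fun i => ?_)
    · exact mul_nonneg_iff_of_pos_left (inv_pos.mpr hs0)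
    · rw [inv_mul_le_iff₀ hs0, mul_one]
  have h1 := Measure.setIntegral_comp_smul_of_pos volume G (Set.Icc (0 : Fin m → ℝ) 1) hs0
  rw [hset, Module.finrank_fin_fun] at h1
  have hsm : 1 ≤ s ^ m := one_le_pow₀ hs
  have h2 : (∫ x in Set.Icc (0 : Fin m → ℝ) (fun _ => s), G x)
      = s ^ m • ∫ x in Set.Icc (0 : Fin m → ℝ) 1, G (s • x) := by
    rw [h1, smul_smul, mul_inv_cancel₀ (by positivity), one_smul]
  have hsub : Set.Icc (0 : Fin m → ℝ) 1 ⊆ Set.Icc (0 : Fin m → ℝ) (fun _ => s) :=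
    Set.Icc_subset_Icc_right (fun i => hs)
  have hone : (1 : Fin m → ℝ) = fun _ => (1:ℝ) := rfl
  have hint : IntegrableOn G (Set.Icc (0 : Fin m → ℝ) (fun _ => s)) :=
    hG.continuousOn.integrableOn_compact isCompact_Icc
  have h3 := setIntegral_sdiff (μ := volume) (f := G) (measurableSet_Icc) hint hsub
  have h4 : ‖∫ x in Set.Icc (0 : Fin m → ℝ) (fun _ => s) \ Set.Icc (0 : Fin m → ℝ) 1, G x‖
      ≤ s ^ m - 1 := by
    have hfin : volume (Set.Icc (0 : Fin m → ℝ) (fun _ => s) \ Set.Icc (0 : Fin m → ℝ) 1) < ⊤ :=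
      (measure_mono Set.sdiff_subset).trans_lt isCompact_Icc.measure_lt_top
    refine (norm_setIntegral_le_of_norm_le_const hfin fun x _ => hn x).trans ?_
    rw [measureReal_sdiff hsub measurableSet_Icc (h₁ := isCompact_Icc.measure_lt_top.ne), hvol s hs0.le, hone, hvol 1 zero_le_one]
    simp
  have h5 : ‖∫ x in Set.Icc (0 : Fin m → ℝ) 1, G (s • x)‖ ≤ 1 := by
    refine (norm_setIntegral_le_of_norm_le_const isCompact_Icc.measure_lt_top
      fun x _ => hn _).trans ?_
    rw [hone, hvol 1 zero_le_one]
    simp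
  set A := ∫ x in Set.Icc (0 : Fin m → ℝ) 1, G (s • x)
  set B := ∫ x in Set.Icc (0 : Fin m → ℝ) 1, G x
  have h6 : A - B = (∫ x in Set.Icc (0 : Fin m → ℝ) (fun _ => s) \ Set.Icc (0 : Fin m → ℝ) 1, G x)
      - (s ^ m - 1) • A := by
    rw [h3, h2, sub_smul, one_smul]; abel
  rw [h6]
  refine (norm_sub_le _ _).trans ?_
  rw [norm_smul, Real.norm_of_nonneg (by linarith)]
  nlinarith

/-- **Oscillatory integral lemma (Annexe D).** If `p` is a nonconstant polynomial on
`ℝ^m`, then `∫_{[0,1]^m} e^{i p (a x)} dx → 0` as `a → ∞`. -/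
theorem oscillatory_integral_tendsto_zero {m : ℕ}
    (p : MvPolynomial (Fin m) ℝ) (hp : p.totalDegree ≠ 0) :
    Filter.Tendsto
      (fun a : ℝ => ∫ x in Set.Icc (0 : Fin m → ℝ) 1,
        Complex.exp (Complex.I * (MvPolynomial.eval (fun i => a * x i) p : ℝ)))
      Filter.atTop (nhds 0) := by
  let F : (Fin m → ℝ) → ℂ := fun y => Complex.exp (Complex.I * (MvPolynomial.eval y p : ℝ))
  have hF : Continuous F := by
    have := MvPolynomial.continuous_eval p
    fun_prop
  have hFn : ∀ y, ‖F y‖ = 1 := by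
    intro y; simp only [F]; rw [mul_comm]; exact Complex.norm_exp_ofReal_mul_I _
  let C : Set (Fin m → ℝ) := Set.Icc 0 1
  let J : ℝ → ℂ := fun a => ∫ x in C, F (a • x)
  change Filter.Tendsto J Filter.atTop (nhds 0)
  have hCfin : volume C < ⊤ := isCompact_Icc.measure_lt_top
  have hJc : Continuous J := by
    apply continuous_parametric_integral_of_continuous
    · exact hF.comp (by fun_prop)
    · exact isCompact_Icc
  have hae : ∀ᵐ x : Fin m → ℝ, ∀ b : ℝ, 1 ≤ b → Filter.Tendsto
      (fun a : ℝ => ∫ s in (1:ℝ)..b, F ((a * s) • x)) Filter.atTop (nhds 0) := by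
    have hne : p - MvPolynomial.C (MvPolynomial.eval 0 p) ≠ 0 := by
      intro h
      apply hp
      rw [sub_eq_zero.mp h, MvPolynomial.totalDegree_C]
    filter_upwards [ae_eval_ne_zero _ hne] with x hx b hb
    let P : Polynomial ℝ :=
      MvPolynomial.aeval (fun i => Polynomial.C (x i) * Polynomial.X) p
    have hPe : ∀ t : ℝ, P.eval t = MvPolynomial.eval (t • x) p := by
      intro t
      have : (Polynomial.aeval t) P = MvPolynomial.aeval (t • x) p := by
        simp only [P]
        rw [MvPolynomial.comp_aeval_apply]
        congr 2
        ext i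
        rw [map_mul, Polynomial.aeval_C, Polynomial.aeval_X, Pi.smul_apply, smul_eq_mul, mul_comm]
        rfl
      rw [Polynomial.coe_aeval_eq_eval] at this
      exact this
    have hP : P.derivative ≠ 0 := by
      intro h
      have hc := Polynomial.eq_C_of_derivative_eq_zero h
      have e0 := hPe 0
      have e1 := hPe 1
      rw [hc] at e0 e1
      simp only [Polynomial.eval_C, zero_smul, one_smul] at e0 e1
      apply hx
      rw [map_sub, MvPolynomial.eval_C, ← e0, ← e1, sub_self]
    have := key2 P hP b hb
    simpa only [hPe] using this
  have hav : ∀ b : ℝ, 1 ≤ b →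
      Filter.Tendsto (fun a : ℝ => ∫ s in (1:ℝ)..b, J (a * s)) Filter.atTop (nhds 0) := by
    intro b hb
    have hsw : ∀ a : ℝ, ∫ s in (1:ℝ)..b, J (a * s)
        = ∫ x in C, (∫ s in (1:ℝ)..b, F ((a * s) • x)) := by
      intro a
      apply intervalIntegral_integral_swap
      have hcont : Continuous (Function.uncurry fun (s : ℝ) (x : Fin m → ℝ) => F ((a * s) • x)) :=
        hF.comp (by fun_prop)
      have : IsFiniteMeasure (volume.restrict C) := ⟨by simpa using hCfin⟩
      have : IsFiniteMeasure ((volume : Measure ℝ).restrict (Set.uIoc 1 b)) :=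
        ⟨by simp [Set.uIoc]⟩
      exact Integrable.of_bound hcont.aestronglyMeasurable 1
        (Filter.Eventually.of_forall fun z => (hFn _).le)
    simp_rw [hsw]
    have hz : (0 : ℂ) = ∫ x in C, (0 : ℂ) := by simp
    rw [hz]
    apply tendsto_integral_filter_of_dominated_convergence (fun _ => |b - 1|)
    · refine Filter.Eventually.of_forall fun a => Continuous.aestronglyMeasurable ?_
      apply intervalIntegral.continuous_parametric_intervalIntegral_of_continuous'
      exact hF.comp (by fun_prop)
    · refine Filter.Eventually.of_forall fun a => Filter.Eventually.of_forall fun x => ?_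
      have := intervalIntegral.norm_integral_le_of_norm_le_const (a := 1) (b := b) (C := 1)
        (f := fun s : ℝ => F ((a * s) • x)) (fun s _ => (hFn _).le)
      simpa using this
    · exact integrableOn_const hCfin.ne
    · filter_upwards [ae_restrict_of_ae hae] with x hx using hx b hb
  rw [Metric.tendsto_nhds]
  intro ε hε
  obtain ⟨b, hb1, hb⟩ : ∃ b : ℝ, 1 < b ∧ b ^ m - 1 < ε / 4 := by
    have hc : Filter.Tendsto (fun b : ℝ => b ^ m - 1) (nhdsWithin 1 (Set.Ioi 1)) (nhds 0) := by
      have : Continuous fun b : ℝ => b ^ m - 1 := by fun_prop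
      simpa using (this.tendsto 1).mono_left nhdsWithin_le_nhds
    have h := (hc.eventually (gt_mem_nhds (show (0:ℝ) < ε / 4 by positivity))).and
      self_mem_nhdsWithin
    obtain ⟨b, h1, h2⟩ := h.exists
    exact ⟨b, h2, h1⟩
  have hb0 : 0 < b - 1 := by linarith
  filter_upwards [(Metric.tendsto_nhds.mp (hav b hb1.le)) (ε / 2 * (b - 1)) (by positivity)]
    with a ha
  rw [dist_zero_right] at ha ⊢
  have hdiff : ‖∫ s in (1:ℝ)..b, (J (a * s) - J a)‖ ≤ 2 * (b ^ m - 1) * |b - 1| := by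
    apply intervalIntegral.norm_integral_le_of_norm_le_const
    intro s hs
    rw [Set.uIoc_of_le hb1.le] at hs
    have := scale_bound (fun x => F (a • x)) (hF.comp (by fun_prop)) (fun x => (hFn _).le) s hs.1.le
    simp only [smul_smul] at this
    refine this.trans ?_
    have : s ^ m ≤ b ^ m := pow_le_pow_left₀ (by linarith [hs.1]) hs.2 m
    linarith
  have hJi : Continuous fun s : ℝ => J (a * s) := hJc.comp (by fun_prop)
  rw [intervalIntegral.integral_sub (hJi.intervalIntegrable _ _)
    (by simp), intervalIntegral.integral_const, abs_of_pos hb0] at hdiff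
  have h7 := norm_sub_norm_le ((b - 1) • J a) (∫ s in (1:ℝ)..b, J (a * s))
  rw [norm_sub_rev, norm_smul, Real.norm_of_nonneg hb0.le] at h7
  have h8 : (b - 1) * ‖J a‖ < (b - 1) * ε := by nlinarith
  exact lt_of_mul_lt_mul_left h8 hb0.le
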